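/- Let q be a prime power and d a positive integer. The average number of periodic points, taken over all polynomials f ∈ F_q[x] with deg(f) = d, is at least (5/6)·min{d, ⌊√q⌋}. -/

import Mathlib

open Polynomial

/-- Polynomials of degree `d` over a finite field form a finite type. -/
theorem Polynomial.finite_degree_eq {F : Type*} [Field F] [Finite F] (d : ℕ) :
    Finite {f : F[X] // f.degree = (d : WithBot ℕ)} := by
  have : Finite (degreeLT F (d + 1)) := Finite.of_equiv _ (degreeLTEquiv F (d + 1)).symm.toEquiv
  refine Finite.of_injective
    (fun f : {f : F[X] // f.degree = (d : WithBot ℕ)} => (⟨f.1, ?_⟩ : degreeLT F (d + 1))) ?_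
  · rw [mem_degreeLT, f.2]
    exact_mod_cast Nat.lt_succ_self d
  · intro f g h
    exact Subtype.ext (congrArg (fun x : degreeLT F (d + 1) => (x : F[X])) h)

/-- The number of polynomials of degree `d` taking prescribed values at `n ≤ d` distinct points does
not depend on these values. -/
theorem Polynomial.card_degree_eq_and_eval_congr {F ι : Type*} [Field F] [Fintype ι]
    {d : ℕ} (hd : Fintype.card ι ≤ d) (v : ι ↪ F) (w w' : ι → F) :
    Nat.card {f : {f : F[X] // f.degree = (d : WithBot ℕ)} // (fun i => f.1.eval (v i)) = w} =
      Nat.card {f : {f : F[X] // f.degree = (d : WithBot ℕ)} //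
        (fun i => f.1.eval (v i)) = w'} := by
  classical
  set g := Lagrange.interpolate Finset.univ v (w' - w) with hg
  have hdeg : g.degree < d :=
    (Lagrange.degree_interpolate_lt _ v.injective.injOn).trans_le (by exact_mod_cast hd)
  have heval (i : ι) : g.eval (v i) = w' i - w i :=
    Lagrange.eval_interpolate_at_node _ v.injective.injOn (Finset.mem_univ i)
  refine Nat.card_congr
    { toFun := fun f => ⟨⟨f.1.1 + g, ?_⟩, ?_⟩
      invFun := fun f => ⟨⟨f.1.1 - g, ?_⟩, ?_⟩
      left_inv := fun f => by simp
      right_inv := fun f => by simp }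
  · rw [degree_add_eq_left_of_degree_lt (by rwa [f.1.2]), f.1.2]
  · ext i
    simp [heval, ← f.2]
  · rw [degree_sub_eq_left_of_degree_lt (by rwa [f.1.2]), f.1.2]
  · ext i
    simp [heval, ← f.2]

/-- Among the polynomials of degree `d`, the proportion of those taking prescribed values at `n ≤ d`
distinct points is `q⁻ⁿ`. -/
theorem Polynomial.card_degree_eq_and_eval_mul {F ι : Type*} [Field F] [Fintype F] [Fintype ι]
    {d : ℕ} (hd : Fintype.card ι ≤ d) (v : ι ↪ F) (w : ι → F) :
    Fintype.card F ^ Fintype.card ι *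
      Nat.card {f : {f : F[X] // f.degree = (d : WithBot ℕ)} // (fun i => f.1.eval (v i)) = w} =
      Nat.card {f : F[X] // f.degree = (d : WithBot ℕ)} := by
  classical
  have := finite_degree_eq (F := F) d
  rw [← Nat.card_congr (Equiv.sigmaFiberEquiv
    fun (f : {f : F[X] // f.degree = (d : WithBot ℕ)}) i => f.1.eval (v i)), Nat.card_sigma,
    Finset.sum_congr rfl fun w' _ => card_degree_eq_and_eval_congr hd v w' w]
  simp

/-- A cyclically ordered tuple on which `g` acts as a shift is the orbit of its first entry. -/
theorem iterate_eq_of_map_eq_add_one {α : Type*} {k : ℕ} {g : α → α} {v : Fin (k + 1) → α}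
    (h : ∀ i, g (v i) = v (i + 1)) (n : ℕ) : g^[n] (v 0) = v (Fin.ofNat (k + 1) n) := by
  induction n with
  | zero => simp
  | succ n ih => rw [Function.iterate_succ_apply', ih, h]; congr 1; ext; simp [Fin.val_add]

/-- The first entry of a `g`-cycle of length `k + 1` has minimal period `k + 1`. -/
theorem minimalPeriod_eq_of_map_eq_add_one {α : Type*} {k : ℕ} {g : α → α}
    {v : Fin (k + 1) → α} (hv : v.Injective) (h : ∀ i, g (v i) = v (i + 1)) :
    Function.minimalPeriod g (v 0) = k + 1 := by
  have hdvd (n : ℕ) : Function.minimalPeriod g (v 0) ∣ n ↔ (k + 1) ∣ n := by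
    rw [← Function.isPeriodicPt_iff_minimalPeriod_dvd, Function.IsPeriodicPt,
      Function.IsFixedPt, iterate_eq_of_map_eq_add_one h, hv.eq_iff, Fin.ext_iff]
    simp [Nat.dvd_iff_mod_eq_zero]
  exact Nat.dvd_antisymm ((hdvd _).2 dvd_rfl) ((hdvd _).1 dvd_rfl)

/-- Lower bound for the number of pairs (polynomial of degree `d`, periodic point) obtained by
counting cycles of length at most `m ≤ d`. -/
theorem Polynomial.sum_card_cycles_le {F : Type*} [Field F] [Fintype F] {d m : ℕ} (hm : m ≤ d) :
    ∑ k ∈ Finset.range m, ((Fintype.card F).descFactorial (k + 1) : ℝ) /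
        (Fintype.card F : ℝ) ^ (k + 1) * Nat.card {f : F[X] // f.degree = (d : WithBot ℕ)} ≤
      Nat.card {p : F[X] × F // p.1.degree = (d : WithBot ℕ) ∧
        ∃ n : ℕ, 0 < n ∧ (fun x => p.1.eval x)^[n] p.2 = p.2} := by
  classical
  have := finite_degree_eq (F := F) d
  let C (k : Fin m) (v : Fin (k + 1) ↪ F) : Type _ :=
    {f : {f : F[X] // f.degree = (d : WithBot ℕ)} // (fun i => f.1.eval (v i)) = fun i => v (i + 1)}
  have hfin : Finite {p : F[X] × F // p.1.degree = (d : WithBot ℕ) ∧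
        ∃ n : ℕ, 0 < n ∧ (fun x => p.1.eval x)^[n] p.2 = p.2} :=
    Finite.of_injective (β := {f : F[X] // f.degree = (d : WithBot ℕ)} × F)
      (fun p => (⟨p.1.1, p.2.1⟩, p.1.2)) fun p p' h => by
        simp only [Prod.mk.injEq, Subtype.mk.injEq] at h
        exact Subtype.ext (Prod.ext h.1 h.2)
  let φ (c : Σ k : Fin m, Σ v : Fin (k + 1) ↪ F, C k v) :
      {p : F[X] × F // p.1.degree = (d : WithBot ℕ) ∧
        ∃ n : ℕ, 0 < n ∧ (fun x => p.1.eval x)^[n] p.2 = p.2} :=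
    ⟨(c.2.2.1.1, c.2.1 0), c.2.2.1.2, c.1 + 1, Nat.succ_pos _, by
      have := iterate_eq_of_map_eq_add_one (g := fun x => c.2.2.1.1.eval x)
        (congrFun c.2.2.2) (c.1 + 1)
      rw [this]
      congr 1
      ext
      simp⟩
  have hφ : φ.Injective := by
    rintro ⟨k, v, ⟨⟨f, hf⟩, hfv⟩⟩ ⟨k', v', ⟨⟨f', hf'⟩, hfv'⟩⟩ h
    simp only [φ, Subtype.mk.injEq, Prod.mk.injEq] at h
    obtain ⟨rfl, h0⟩ := h
    have hshift (i : Fin (k + 1)) : (fun x => f.eval x) (v i) = v (i + 1) := congrFun hfv i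
    have hshift' (i : Fin (k' + 1)) : (fun x => f.eval x) (v' i) = v' (i + 1) := congrFun hfv' i
    have hk : k = k' := by
      have h₁ := minimalPeriod_eq_of_map_eq_add_one (g := fun x => f.eval x) (v := v) v.injective hshift
      have h₂ := minimalPeriod_eq_of_map_eq_add_one (g := fun x => f.eval x) (v := v') v'.injective hshift'
      rw [← h0, h₁] at h₂
      exact Fin.ext (Nat.succ_injective h₂)
    subst hk
    have hv : v = v' := by
      ext i
      have h₁ := iterate_eq_of_map_eq_add_one (g := fun x => f.eval x) (v := v) hshift i
      have h₂ := iterate_eq_of_map_eq_add_one (g := fun x => f.eval x) (v := v') hshift' i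
      rw [← h0, h₁] at h₂
      simpa using h₂
    subst hv
    rfl
  have hcard (k : Fin m) (v : Fin (k + 1) ↪ F) : (Nat.card (C k v) : ℝ) =
      Nat.card {f : F[X] // f.degree = (d : WithBot ℕ)} / (Fintype.card F : ℝ) ^ (k.1 + 1) := by
    rw [eq_div_iff (by positivity), mul_comm,
      ← card_degree_eq_and_eval_mul (by simp; omega) v fun i => v (i + 1)]
    simp [C]
  have hle : (Nat.card (Σ k : Fin m, Σ v : Fin (k + 1) ↪ F, C k v) : ℝ) ≤ _ :=
    Nat.cast_le.2 (Nat.card_le_card_of_injective φ hφ)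
  refine le_trans (le_of_eq ?_) hle
  have (k : Fin m) (v : Fin (k + 1) ↪ F) : Finite (C k v) := Subtype.finite
  rw [Finset.sum_range, Nat.card_sigma, Nat.cast_sum]
  refine Finset.sum_congr rfl fun k _ => ?_
  rw [Nat.card_sigma, Nat.cast_sum, Finset.sum_congr rfl fun v _ => hcard k v]
  simp [Fintype.card_embedding_eq]
  ring

/-- The probability that `n` independent uniform elements of a `q`-element set are distinct is at
least `1 - n(n-1)/(2q)`. -/
theorem Nat.one_sub_le_descFactorial_div_pow {q : ℕ} (hq : 0 < q) {n : ℕ} (hn : n ≤ q) :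
    1 - (n : ℝ) * (n - 1) / (2 * q) ≤ (q.descFactorial n : ℝ) / (q : ℝ) ^ n := by
  have hq' : (0 : ℝ) < q := by exact_mod_cast hq
  induction n with
  | zero => simp
  | succ n ih =>
    have hnq : (n : ℝ) ≤ q := by exact_mod_cast (Nat.le_succ n).trans hn
    have hfac : ((q.descFactorial (n + 1) : ℕ) : ℝ) / (q : ℝ) ^ (n + 1) =
        (1 - n / q) * ((q.descFactorial n : ℝ) / (q : ℝ) ^ n) := by
      rw [Nat.descFactorial_succ, Nat.cast_mul, Nat.cast_sub ((Nat.le_succ n).trans hn)]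
      field_simp
      ring
    have h1 : (q.descFactorial n : ℝ) / (q : ℝ) ^ n ≤ 1 := by
      rw [div_le_one (by positivity)]
      exact_mod_cast Nat.descFactorial_le_pow q n
    have h2 : (n : ℝ) / q * ((q.descFactorial n : ℝ) / (q : ℝ) ^ n) ≤ n / q :=
      mul_le_of_le_one_right (by positivity) h1
    have h3 : ((n + 1 : ℕ) : ℝ) * ((n + 1 : ℕ) - 1) / (2 * q) =
        (n : ℝ) * (n - 1) / (2 * q) + n / q := by
      push_cast
      field_simp
      ring
    rw [hfac, h3]
    linarith [ih ((Nat.le_succ n).trans hn)]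

/-- A uniform random self-map of a `q`-element set has on average at least `5m/6` points of period
at most `m`, whenever `m² ≤ q`. -/
theorem Nat.five_sixths_mul_le_sum_descFactorial_div_pow {q m : ℕ} (hq : 0 < q)
    (hm : m * m ≤ q) :
    5 / 6 * (m : ℝ) ≤
      ∑ k ∈ Finset.range m, (q.descFactorial (k + 1) : ℝ) / (q : ℝ) ^ (k + 1) := by
  have hq' : (0 : ℝ) < q := by exact_mod_cast hq
  have hsum (l : ℕ) : ∑ k ∈ Finset.range l,
      (1 - ((k + 1 : ℕ) : ℝ) * ((k + 1 : ℕ) - 1) / (2 * q)) =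
      l - ((l : ℝ) ^ 3 - l) / (6 * q) := by
    induction l with
    | zero => simp
    | succ l ih =>
      rw [Finset.sum_range_succ, ih]
      push_cast
      field_simp
      ring
  calc 5 / 6 * (m : ℝ) ≤ m - ((m : ℝ) ^ 3 - m) / (6 * q) := by
        have hm' : (m : ℝ) * m ≤ q := by exact_mod_cast hm
        have : ((m : ℝ) ^ 3 - m) / (6 * q) ≤ m / 6 := by
          rw [div_le_div_iff₀ (by positivity) (by norm_num)]
          nlinarith [mul_le_mul_of_nonneg_left hm' (Nat.cast_nonneg (α := ℝ) m),
            Nat.cast_nonneg (α := ℝ) m]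
        linarith
    _ = _ := (hsum m).symm
    _ ≤ _ := Finset.sum_le_sum fun k hk =>
        one_sub_le_descFactorial_div_pow hq (by have := Finset.mem_range.1 hk; nlinarith)

open Polynomial

/-- **Corollary 2.5 (explicit form).** The average number of periodic points of a degree-`d`
polynomial over `F_q` is at least `(5/6)⬝min{d, ⌊√q⌋}`.  The average is formalized as the number
of pairs `(f, α)` with `deg f = d` and `α ∈ F_q` periodic for `f`, divided by the number of `f`
of degree `d`. -/
theorem avg_periodic_points_of_polynomials_explicit_lower_bound
    (q d : ℕ) (F : Type) [Field F] [Fintype F] (hF : Fintype.card F = q)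
    (hd : 0 < d) :
    (Nat.card {p : Polynomial F × F //
        p.1.degree = (d : WithBot ℕ) ∧
          ∃ n : ℕ, 0 < n ∧ (fun x => p.1.eval x)^[n] p.2 = p.2} : ℝ) /
      (Nat.card {f : Polynomial F // f.degree = (d : WithBot ℕ)} : ℝ)
      ≥ 5 / 6 * min d (Nat.sqrt q) := by
  subst hF
  have hfin := finite_degree_eq (F := F) d
  have : Nonempty {f : F[X] // f.degree = (d : WithBot ℕ)} := ⟨⟨X ^ d, degree_X_pow d⟩⟩
  have hsqrt : min d (Nat.sqrt (Fintype.card F)) * min d (Nat.sqrt (Fintype.card F)) ≤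
      Fintype.card F :=
    (Nat.mul_le_mul (min_le_right _ _) (min_le_right _ _)).trans (Nat.sqrt_le _)
  rw [ge_iff_le, le_div_iff₀ (by exact_mod_cast Nat.card_pos)]
  refine le_trans ?_ (sum_card_cycles_le (F := F) (min_le_left d (Nat.sqrt (Fintype.card F))))
  rw [← Finset.sum_mul]
  exact mul_le_mul_of_nonneg_right
    (Nat.five_sixths_mul_le_sum_descFactorial_div_pow Fintype.card_pos hsqrt) (Nat.cast_nonneg _)
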